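/- arXiv:2311.02865 — 2 statements merged into one kernel-verified Lean document; each statement's English description precedes it below -/
import Mathlib

section
/- Let α ∈ (0, 1/2), for each positive integer n let t_n* ∈ (0, n) be the unique solution of P_n(t_n*) = α, and set τ_n* = t_n*/n. Then lim_{n→∞} n·(τ_n* − α) = 1/μ*; equivalently, τ_n* = α + 1/(μ* n) + o(1/n) as n → ∞. -/
open MeasureTheory Filter

/-- The truncated cube `𝒯_n(t) = {x ∈ [0,1]^n : ∑ i, x i ≤ t}`. -/
def truncCube (n : ℕ) (t : ℝ) : Set (Fin n → ℝ) :=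
  {x | (∀ i, x i ∈ Set.Icc (0 : ℝ) 1) ∧ ∑ i, x i ≤ t}

/-- Volume of the truncated cube. -/
noncomputable def truncVol (n : ℕ) (t : ℝ) : ℝ :=
  (volume (truncCube n t)).toReal

/-- Average first moment of the truncated cube. -/
noncomputable def truncMoment (n : ℕ) (t : ℝ) : ℝ :=
  (1 / (n * truncVol n t)) * ∫ x in truncCube n t, ∑ i, x i

/-- Average of `g` over the unit window `[t - 1, t]`. -/
noncomputable def windowAvg (g : ℝ → ℝ) (t : ℝ) : ℝ :=
  ∫ u in (0 : ℝ)..1, g (t - u)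

theorem Monotone.intervalIntegrable_sub {g : ℝ → ℝ} (hg : Monotone g) (t a b : ℝ) :
    IntervalIntegrable (fun u => g (t - u)) volume a b :=
  Antitone.intervalIntegrable fun _ _ h => hg (sub_le_sub_left h t)

theorem windowAvg_eq (g : ℝ → ℝ) (t : ℝ) : windowAvg g t = ∫ u in (t - 1)..t, g u := by
  simp [windowAvg]

theorem Monotone.windowAvg {g : ℝ → ℝ} (hg : Monotone g) : Monotone (windowAvg g) :=
  fun s t h => intervalIntegral.integral_mono_on zero_le_one (hg.intervalIntegrable_sub s 0 1)
    (hg.intervalIntegrable_sub t 0 1) fun u _ => hg (sub_le_sub_right h u)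

/-- Relations between a function `w` and its derivative `v` that are stable under window averages:
both are monotone and nonnegative, `v / w` is antitone (so `w` is log-concave), and the increment of
`w` over `[s, t]` is at most `(t - s) * v t`. -/
structure LogConcavePair (v w : ℝ → ℝ) : Prop where
  mono_left : Monotone v
  mono_right : Monotone w
  nonneg_left : 0 ≤ v
  nonneg_right : 0 ≤ w
  cross : ∀ s t, s ≤ t → v t * w s ≤ v s * w t
  increment : ∀ s t, s ≤ t → w t - w s ≤ (t - s) * v t

theorem LogConcavePair.integral_cross {v w : ℝ → ℝ} (h : LogConcavePair v w) {a b c d : ℝ}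
    (hab : a ≤ b) (hbc : b ≤ c) (hcd : c ≤ d) :
    (∫ x in c..d, v x) * (∫ x in a..b, w x) ≤ (∫ x in a..b, v x) * (∫ x in c..d, w x) := by
  have hv := fun p q => h.mono_left.intervalIntegrable (μ := volume) (a := p) (b := q)
  have hw := fun p q => h.mono_right.intervalIntegrable (μ := volume) (a := p) (b := q)
  rw [mul_comm, ← intervalIntegral.integral_mul_const, ← intervalIntegral.integral_mul_const]
  refine intervalIntegral.integral_mono_on hab ((hw a b).mul_const _) ((hv a b).mul_const _)
    fun x hx => ?_
  rw [← intervalIntegral.integral_const_mul, ← intervalIntegral.integral_const_mul]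
  refine intervalIntegral.integral_mono_on hcd ((hv c d).const_mul _) ((hw c d).const_mul _)
    fun y hy => ?_
  rw [mul_comm]
  exact h.cross x y (hx.2.trans (hbc.trans hy.1))

theorem LogConcavePair.windowAvg {v w : ℝ → ℝ} (h : LogConcavePair v w) :
    LogConcavePair (windowAvg v) (windowAvg w) where
  mono_left := h.mono_left.windowAvg
  mono_right := h.mono_right.windowAvg
  nonneg_left t := intervalIntegral.integral_nonneg zero_le_one fun u _ => h.nonneg_left _
  nonneg_right t := intervalIntegral.integral_nonneg zero_le_one fun u _ => h.nonneg_right _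
  cross s t hst := by
    simp only [windowAvg_eq]
    rcases le_total s (t - 1) with hs | hs
    · exact h.integral_cross (by linarith) hs (by linarith)
    · have hv := fun p q => h.mono_left.intervalIntegrable (μ := volume) (a := p) (b := q)
      have hw := fun p q => h.mono_right.intervalIntegrable (μ := volume) (a := p) (b := q)
      rw [← intervalIntegral.integral_add_adjacent_intervals (hv (s - 1) (t - 1)) (hv (t - 1) s),
        ← intervalIntegral.integral_add_adjacent_intervals (hw (s - 1) (t - 1)) (hw (t - 1) s),
        ← intervalIntegral.integral_add_adjacent_intervals (hv (t - 1) s) (hv s t),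
        ← intervalIntegral.integral_add_adjacent_intervals (hw (t - 1) s) (hw s t)]
      have h1 := h.integral_cross (a := s - 1) (b := t - 1) (by linarith) le_rfl hs
      have h2 := h.integral_cross hs le_rfl hst
      have h3 := h.integral_cross (a := s - 1) (b := t - 1) (by linarith) hs hst
      linarith
  increment s t hst := by
    simp only [_root_.windowAvg]
    rw [← intervalIntegral.integral_sub (h.mono_right.intervalIntegrable_sub t 0 1)
      (h.mono_right.intervalIntegrable_sub s 0 1), ← intervalIntegral.integral_const_mul]
    refine intervalIntegral.integral_mono_on zero_le_one
      ((h.mono_right.intervalIntegrable_sub t 0 1).sub (h.mono_right.intervalIntegrable_sub s 0 1))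
      ((h.mono_left.intervalIntegrable_sub t 0 1).const_mul _) fun u _ => ?_
    simpa using h.increment (s - u) (t - u) (by linarith)

theorem LogConcavePair.windowAvg_iterate {v w : ℝ → ℝ} (h : LogConcavePair v w) (n : ℕ) :
    LogConcavePair (_root_.windowAvg^[n] v) (_root_.windowAvg^[n] w) := by
  induction n with
  | zero => exact h
  | succ n ih => simpa only [Function.iterate_succ_apply'] using ih.windowAvg

/-- The right-continuous unit step. -/
noncomputable def unitStep : ℝ → ℝ := (Set.Ici (0 : ℝ)).indicator 1

theorem logConcavePair_unitStep : LogConcavePair unitStep (fun x => max x 0) where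
  mono_left s t h := by
    unfold unitStep Set.indicator
    simp only [Set.mem_Ici]
    split_ifs <;> first | linarith | simp
  mono_right s t h := max_le_max_right 0 h
  nonneg_left := Set.indicator_nonneg fun _ _ => zero_le_one
  nonneg_right _ := le_max_right _ _
  cross s t h := by
    unfold unitStep Set.indicator
    simp only [Set.mem_Ici]
    split_ifs
    · simpa using max_le_max_right 0 h
    · have : s ≤ 0 := by linarith
      simp [this]
    · exfalso; linarith
    · simp
  increment s t h := by
    unfold unitStep Set.indicator
    simp only [Set.mem_Ici]
    split_ifs with ht
    · have := le_max_left s 0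
      rw [max_eq_left ht]; simp; linarith
    · simp [(not_le.1 ht).le]

/-- The low-order Laplace data of a function `g`: its exponentially weighted integral is `a` and its
exponentially weighted first moment is `b`. -/
structure HasLaplaceMoments (l : ℝ) (g : ℝ → ℝ) (a b : ℝ) : Prop where
  integrable_zero : Integrable fun x => Real.exp (-l * x) * g x
  integrable_one : Integrable fun x => x * (Real.exp (-l * x) * g x)
  integral_zero : ∫ x, Real.exp (-l * x) * g x = a
  integral_one : ∫ x, x * (Real.exp (-l * x) * g x) = b

open scoped Convolution in
theorem HasLaplaceMoments.windowAvg {l : ℝ} {g : ℝ → ℝ} {a b : ℝ}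
    (h : HasLaplaceMoments l g a b) :
    HasLaplaceMoments l (windowAvg g)
      ((∫ u in (0 : ℝ)..1, Real.exp (-l * u)) * a)
      ((∫ u in (0 : ℝ)..1, u * Real.exp (-l * u)) * a
        + (∫ u in (0 : ℝ)..1, Real.exp (-l * u)) * b) := by
  set e : ℝ → ℝ := (Set.Ioc (0 : ℝ) 1).indicator fun u => Real.exp (-l * u) with he
  set e' : ℝ → ℝ := (Set.Ioc (0 : ℝ) 1).indicator fun u => u * Real.exp (-l * u) with he'
  have hei : Integrable e := by
    rw [he, integrable_indicator_iff measurableSet_Ioc]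
    exact (Continuous.integrableOn_Icc (by fun_prop)).mono_set Set.Ioc_subset_Icc_self
  have hei' : Integrable e' := by
    rw [he', integrable_indicator_iff measurableSet_Ioc]
    exact (Continuous.integrableOn_Icc (by fun_prop)).mono_set Set.Ioc_subset_Icc_self
  have hie : ∫ u, e u = ∫ u in (0 : ℝ)..1, Real.exp (-l * u) := by
    rw [he, integral_indicator measurableSet_Ioc, intervalIntegral.integral_of_le zero_le_one]
  have hie' : ∫ u, e' u = ∫ u in (0 : ℝ)..1, u * Real.exp (-l * u) := by
    rw [he', integral_indicator measurableSet_Ioc, intervalIntegral.integral_of_le zero_le_one]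
  set G : ℝ → ℝ := fun x => Real.exp (-l * x) * g x with hG
  set L := ContinuousLinearMap.mul ℝ ℝ
  have c0 : (fun x => Real.exp (-l * x) * _root_.windowAvg g x) = (e ⋆[L, volume] G) := by
    funext x
    rw [convolution_def, _root_.windowAvg, ← intervalIntegral.integral_const_mul,
      intervalIntegral.integral_of_le zero_le_one, ← integral_indicator measurableSet_Ioc]
    congr 1
    funext u
    by_cases hu : u ∈ Set.Ioc (0 : ℝ) 1
    · simp only [he, hG, Set.indicator_of_mem hu, L, ContinuousLinearMap.mul_apply']
      rw [← mul_assoc, ← Real.exp_add]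
      congr 2
      ring
    · simp [he, Set.indicator_of_notMem hu]
  have c1 : (fun x => x * (Real.exp (-l * x) * _root_.windowAvg g x)) =ᵐ[volume]
      (e' ⋆[L, volume] G) + (e ⋆[L, volume] fun x => x * G x) := by
    filter_upwards [hei'.ae_convolution_exists L h.integrable_zero,
      hei.ae_convolution_exists L h.integrable_one] with x h1 h2
    rw [congrFun c0 x, Pi.add_apply, convolution_def, convolution_def, convolution_def,
      ← integral_const_mul, ← integral_add h1 h2]
    congr 1
    funext u
    by_cases hu : u ∈ Set.Ioc (0 : ℝ) 1
    · simp only [he, he', Set.indicator_of_mem hu, L, ContinuousLinearMap.mul_apply']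
      ring
    · simp [he, he', Set.indicator_of_notMem hu]
  have i1 := hei'.integrable_convolution L h.integrable_zero
  have i2 := hei.integrable_convolution L h.integrable_one
  refine ⟨?_, (i1.add i2).congr c1.symm, ?_, ?_⟩
  · rw [c0]
    exact hei.integrable_convolution L h.integrable_zero
  · rw [c0, integral_convolution L hei h.integrable_zero, hie, h.integral_zero]
    rfl
  · rw [integral_congr_ae c1, integral_add' i1 i2, integral_convolution L hei' h.integrable_zero,
      integral_convolution L hei h.integrable_one, hie, hie', h.integral_zero, h.integral_one]
    rfl

theorem integral_zero_one_exp_neg_mul {l : ℝ} (hl : 0 < l) :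
    ∫ u in (0 : ℝ)..1, Real.exp (-l * u) = (1 - Real.exp (-l)) / l := by
  have hd : ∀ x ∈ Set.uIcc (0 : ℝ) 1,
      HasDerivAt (fun x => -Real.exp (-l * x) / l) (Real.exp (-l * x)) x := fun x _ => by
    have := ((((hasDerivAt_id x).const_mul (-l)).exp).neg).div_const l
    refine this.congr_deriv ?_
    simp only [id]
    field_simp
  rw [intervalIntegral.integral_eq_sub_of_hasDerivAt hd
    (Continuous.intervalIntegrable (by fun_prop) _ _)]
  simp
  ring

theorem integral_zero_one_mul_exp_neg_mul {l : ℝ} (hl : 0 < l) :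
    ∫ u in (0 : ℝ)..1, u * Real.exp (-l * u)
      = (1 - Real.exp (-l)) / l * (1 / l - 1 / (Real.exp l - 1)) := by
  have hd : ∀ x ∈ Set.uIcc (0 : ℝ) 1,
      HasDerivAt (fun x => -Real.exp (-l * x) * (x / l + 1 / l ^ 2))
        (x * Real.exp (-l * x)) x := fun x _ => by
    have := ((((hasDerivAt_id x).const_mul (-l)).exp).neg).mul
      (((hasDerivAt_id x).div_const l).add_const (1 / l ^ 2))
    refine this.congr_deriv ?_
    simp only [id, Pi.neg_apply]
    field_simp
    ring
  rw [intervalIntegral.integral_eq_sub_of_hasDerivAt hd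
    (Continuous.intervalIntegrable (by fun_prop) _ _)]
  have h1 : Real.exp l - 1 ≠ 0 := by
    have := Real.add_one_lt_exp hl.ne'
    linarith
  simp only [mul_one, mul_zero, Real.exp_zero, Real.exp_neg]
  have := Real.exp_ne_zero l
  field_simp
  ring

theorem HasLaplaceMoments.windowAvg_iterate {l : ℝ} (hl : 0 < l) {g : ℝ → ℝ} {a b : ℝ}
    (h : HasLaplaceMoments l g a b) (n : ℕ) :
    HasLaplaceMoments l (_root_.windowAvg^[n] g)
      (((1 - Real.exp (-l)) / l) ^ n * a)
      (((1 - Real.exp (-l)) / l) ^ n * (b + n * (1 / l - 1 / (Real.exp l - 1)) * a)) := by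
  induction n with
  | zero => simpa using h
  | succ n ih =>
    rw [Function.iterate_succ_apply']
    convert ih.windowAvg using 1
    · rw [integral_zero_one_exp_neg_mul hl]
      ring
    · rw [integral_zero_one_exp_neg_mul hl, integral_zero_one_mul_exp_neg_mul hl]
      push_cast
      ring

theorem integrableOn_pow_mul_exp_neg_mul {l : ℝ} (hl : 0 < l) (k : ℕ) :
    IntegrableOn (fun x => x ^ k * Real.exp (-l * x)) (Set.Ici 0) := by
  rw [integrableOn_Ici_iff_integrableOn_Ioi]
  simpa using integrableOn_rpow_mul_exp_neg_mul_rpow (s := k) (p := 1) (b := l)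
    (by have : (0 : ℝ) ≤ k := k.cast_nonneg
        linarith) one_pos hl

theorem integral_pow_mul_exp_neg_mul {l : ℝ} (hl : 0 < l) (k : ℕ) :
    ∫ x in Set.Ici 0, x ^ k * Real.exp (-l * x) = k.factorial / l ^ (k + 1) := by
  have h := Real.integral_rpow_mul_exp_neg_mul_Ioi (a := (k : ℝ) + 1) (r := l) (by positivity) hl
  rw [integral_Ici_eq_integral_Ioi]
  rw [Real.Gamma_nat_eq_factorial, add_sub_cancel_right] at h
  simp only [Real.rpow_natCast, ← neg_mul] at h
  rw [h, ← Nat.cast_succ, Real.rpow_natCast, one_div, inv_pow]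
  field_simp

theorem hasLaplaceMoments_pow {l : ℝ} (hl : 0 < l) (k : ℕ) :
    HasLaplaceMoments l ((Set.Ici (0 : ℝ)).indicator (· ^ k))
      (k.factorial / l ^ (k + 1)) ((k + 1).factorial / l ^ (k + 2)) := by
  have e0 : (fun x => Real.exp (-l * x) * (Set.Ici (0 : ℝ)).indicator (· ^ k) x)
      = (Set.Ici (0 : ℝ)).indicator fun x => x ^ k * Real.exp (-l * x) := by
    funext x
    by_cases hx : x ∈ Set.Ici (0 : ℝ) <;> simp [hx, mul_comm]
  have e1 : (fun x => x * (Real.exp (-l * x) * (Set.Ici (0 : ℝ)).indicator (· ^ k) x))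
      = (Set.Ici (0 : ℝ)).indicator fun x => x ^ (k + 1) * Real.exp (-l * x) := by
    funext x
    rw [congrFun e0 x]
    by_cases hx : x ∈ Set.Ici (0 : ℝ)
    · simp only [Set.indicator_of_mem hx]
      ring
    · simp only [Set.indicator_of_notMem hx, mul_zero]
  constructor
  · rw [e0, integrable_indicator_iff measurableSet_Ici]
    exact integrableOn_pow_mul_exp_neg_mul hl k
  · rw [e1, integrable_indicator_iff measurableSet_Ici]
    exact integrableOn_pow_mul_exp_neg_mul hl (k + 1)
  · rw [e0, integral_indicator measurableSet_Ici, integral_pow_mul_exp_neg_mul hl]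
  · rw [e1, integral_indicator measurableSet_Ici, integral_pow_mul_exp_neg_mul hl]

theorem windowAvg_iterate_laplace_le {l : ℝ} (hl : 0 < l) (n : ℕ) (s : ℝ) :
    windowAvg^[n] (fun x => max x 0) s * (1 + l * (n * (1 / l - 1 / (Real.exp l - 1)) - s))
      ≤ windowAvg^[n] unitStep s * (2 / l + (n * (1 / l - 1 / (Real.exp l - 1)) - s)) := by
  have hv : HasLaplaceMoments l unitStep (1 / l) (1 / l ^ 2) := by
    convert hasLaplaceMoments_pow hl 0 using 1
    · simp only [unitStep, pow_zero]
      rfl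
    · simp
    · simp
  have hw : HasLaplaceMoments l (fun x => max x 0) (1 / l ^ 2) (2 / l ^ 3) := by
    convert hasLaplaceMoments_pow hl 1 using 1
    · funext x
      by_cases hx : 0 ≤ x
      · simp [hx]
      · simp [hx, (not_le.1 hx).le]
    · simp
    · simp [Nat.factorial]
  have hp := logConcavePair_unitStep.windowAvg_iterate n
  replace hv := hv.windowAvg_iterate hl n
  replace hw := hw.windowAvg_iterate hl n
  set v := windowAvg^[n] unitStep
  set w := windowAvg^[n] fun x => max x 0
  set m := 1 / l - 1 / (Real.exp l - 1)
  have hφ : 0 < ((1 - Real.exp (-l)) / l) ^ n := by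
    have : Real.exp (-l) < 1 := by simpa using hl
    have : 0 < 1 - Real.exp (-l) := by linarith
    positivity
  set φ := ((1 - Real.exp (-l)) / l) ^ n
  have iv := hv.integrable_one.sub (hv.integrable_zero.const_mul s)
  have iw := hw.integrable_one.sub (hw.integrable_zero.const_mul s)
  have key : w s * ∫ x, (x * (Real.exp (-l * x) * v x) - s * (Real.exp (-l * x) * v x))
      ≤ v s * ∫ x, (x * (Real.exp (-l * x) * w x) - s * (Real.exp (-l * x) * w x)) := by
    rw [← integral_const_mul, ← integral_const_mul]
    refine integral_mono (iv.const_mul _) (iw.const_mul _) fun x => ?_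
    have hx : (x - s) * (v x * w s) ≤ (x - s) * (v s * w x) := by
      rcases le_total s x with h | h
      · exact mul_le_mul_of_nonneg_left (hp.cross s x h) (sub_nonneg.2 h)
      · have := hp.cross x s h
        exact mul_le_mul_of_nonpos_left (by linarith) (sub_nonpos.2 h)
    have := mul_le_mul_of_nonneg_left hx (Real.exp_pos (-l * x)).le
    simp only
    linarith
  rw [integral_sub hv.integrable_one (hv.integrable_zero.const_mul s),
    integral_sub hw.integrable_one (hw.integrable_zero.const_mul s), integral_const_mul,
    integral_const_mul, hv.integral_zero, hv.integral_one, hw.integral_zero,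
    hw.integral_one] at key
  refine le_of_mul_le_mul_left ?_ (by positivity : 0 < φ / l ^ 2)
  refine (Eq.le ?_).trans (key.trans (Eq.le ?_))
  · field_simp
    ring
  · ring

theorem Monotone.integrableOn_cube {ι : Type*} [Fintype ι] {g : ℝ → ℝ} (hg : Monotone g) (t : ℝ) :
    IntegrableOn (fun x : ι → ℝ => g (t - ∑ i, x i)) (Set.Icc 0 1) := by
  refine Measure.integrableOn_of_bounded (M := |g t| + |g (t - Fintype.card ι)|)
    isCompact_Icc.measure_lt_top.ne
    (hg.measurable.comp (by fun_prop)).aestronglyMeasurable ?_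
  filter_upwards [ae_restrict_mem measurableSet_Icc] with x hx
  have h0 : 0 ≤ ∑ i, x i := Finset.sum_nonneg fun i _ => hx.1 i
  have h1 : ∑ i, x i ≤ Fintype.card ι := by
    simpa using Finset.sum_le_sum fun i (_ : i ∈ Finset.univ) => hx.2 i
  have a := hg (show t - ∑ i, x i ≤ t by linarith)
  have b := hg (show t - Fintype.card ι ≤ t - ∑ i, x i by linarith)
  rw [Real.norm_eq_abs, abs_le]
  constructor
  · linarith [neg_abs_le (g (t - Fintype.card ι)), abs_nonneg (g t)]
  · linarith [le_abs_self (g t), abs_nonneg (g (t - Fintype.card ι))]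

theorem Monotone.integral_cube {g : ℝ → ℝ} (hg : Monotone g) (n : ℕ) (t : ℝ) :
    ∫ x in Set.Icc (0 : Fin n → ℝ) 1, g (t - ∑ i, x i) = _root_.windowAvg^[n] g t := by
  induction n generalizing t with
  | zero =>
    simp [Measure.real]
  | succ n ih =>
    rw [Function.iterate_succ_apply', _root_.windowAvg]
    simp_rw [← ih]
    have hm := volume_preserving_piFinSuccAbove (fun _ : Fin (n + 1) => ℝ) 0
    set E := MeasurableEquiv.piFinSuccAbove (fun _ : Fin (n + 1) => ℝ) 0
    have hs : Set.Icc (0 : Fin (n + 1) → ℝ) 1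
        = E ⁻¹' (Set.Icc (0 : ℝ) 1 ×ˢ Set.Icc (0 : Fin n → ℝ) 1) := by
      ext x
      simp [E, Set.mem_Icc, Pi.le_def, Fin.forall_fin_succ, Fin.tail]
    have hf : (fun x : Fin (n + 1) → ℝ => g (t - ∑ i, x i))
        = (fun p : ℝ × (Fin n → ℝ) => g (t - p.1 - ∑ i, p.2 i)) ∘ E := by
      funext x
      simp [E, Fin.sum_univ_succ, Fin.tail, sub_sub]
    have hint := hg.integrableOn_cube (ι := Fin (n + 1)) t
    rw [hf, hs, hm.integrableOn_comp_preimage E.measurableEmbedding] at hint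
    rw [hs]
    have := hm.setIntegral_preimage_emb E.measurableEmbedding
      (fun p : ℝ × (Fin n → ℝ) => g (t - p.1 - ∑ i, p.2 i))
      (Set.Icc (0 : ℝ) 1 ×ˢ Set.Icc (0 : Fin n → ℝ) 1)
    rw [intervalIntegral.integral_of_le zero_le_one, ← integral_Icc_eq_integral_Ioc,
      ← setIntegral_prod (fun p : ℝ × (Fin n → ℝ) => g (t - p.1 - ∑ i, p.2 i)) hint,
      ← Measure.volume_eq_prod, ← this]
    exact setIntegral_congr_fun (E.measurable (measurableSet_Icc.prod measurableSet_Icc))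
      fun x _ => congrFun hf x

theorem truncCube_eq (n : ℕ) (t : ℝ) :
    truncCube n t = Set.Icc (0 : Fin n → ℝ) 1 ∩ {x | ∑ i, x i ≤ t} := by
  ext x
  simp [truncCube, Set.mem_Icc, Pi.le_def, forall_and]

theorem measurableSet_sum_le (n : ℕ) (t : ℝ) : MeasurableSet {x : Fin n → ℝ | ∑ i, x i ≤ t} :=
  measurableSet_le (by fun_prop) measurable_const

theorem truncVol_eq (n : ℕ) (t : ℝ) : truncVol n t = windowAvg^[n] unitStep t := by
  rw [← Monotone.integral_cube logConcavePair_unitStep.mono_left n t, truncVol, truncCube_eq,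
    ← Measure.real, ← setIntegral_one_eq_measureReal, ← setIntegral_indicator
      (measurableSet_sum_le n t)]
  congr 1
  funext x
  by_cases hx : ∑ i, x i ≤ t <;> simp [unitStep, hx]

theorem integral_truncCube_sub (n : ℕ) (t : ℝ) :
    ∫ x in truncCube n t, (t - ∑ i, x i) = windowAvg^[n] (fun x => max x 0) t := by
  rw [← Monotone.integral_cube logConcavePair_unitStep.mono_right n t, truncCube_eq,
    ← setIntegral_indicator (measurableSet_sum_le n t)]
  congr 1
  funext x
  by_cases hx : ∑ i, x i ≤ t
  · simp [hx]
  · simp [hx, (not_le.1 hx).le]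

theorem truncVol_pos_and_first_moment {n : ℕ} (hn : 1 ≤ n) {t α : ℝ} (hα : 0 < α)
    (h : truncMoment n t = α) :
    0 < windowAvg^[n] unitStep t ∧
      windowAvg^[n] (fun x => max x 0) t = (t - n * α) * windowAvg^[n] unitStep t := by
  have hn' : (0 : ℝ) < n := by exact_mod_cast hn
  have hV : truncVol n t ≠ 0 := by
    intro h0
    rw [truncMoment, h0] at h
    simp at h
    exact hα.ne h
  refine ⟨truncVol_eq n t ▸ lt_of_le_of_ne ENNReal.toReal_nonneg hV.symm, ?_⟩
  have hsub : truncCube n t ⊆ Set.Icc 0 1 := truncCube_eq n t ▸ Set.inter_subset_left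
  have hi : IntegrableOn (fun x : Fin n → ℝ => ∑ i, x i) (truncCube n t) :=
    (Continuous.integrableOn_Icc (by fun_prop)).mono_set hsub
  have hc : IntegrableOn (fun _ : Fin n → ℝ => t) (truncCube n t) :=
    continuous_const.integrableOn_Icc.mono_set hsub
  rw [← integral_truncCube_sub, integral_sub hc hi, ← truncVol_eq, setIntegral_const, ← h,
    truncMoment, Measure.real, ← truncVol, smul_eq_mul]
  field_simp

theorem strictAntiOn_one_div_sub_one_div_exp_sub_one :
    StrictAntiOn (fun l : ℝ => 1 / l - 1 / (Real.exp l - 1)) (Set.Ioi 0) := by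
  have hd : ∀ x ∈ Set.Ioi (0 : ℝ), HasDerivAt (fun l : ℝ => 1 / l - 1 / (Real.exp l - 1))
      (-(1 / x ^ 2) + Real.exp x / (Real.exp x - 1) ^ 2) x := fun x (hx : 0 < x) => by
    have h1 : Real.exp x - 1 ≠ 0 := by
      have := Real.add_one_lt_exp hx.ne'
      linarith
    have := (hasDerivAt_inv hx.ne').sub (((Real.hasDerivAt_exp x).sub_const 1).inv h1)
    simp only [one_div]
    refine this.congr_deriv ?_
    ring
  refine strictAntiOn_of_deriv_neg (convex_Ioi 0)
    (fun x hx => (hd x hx).continuousAt.continuousWithinAt) fun x hx => ?_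
  rw [interior_Ioi] at hx
  rw [(hd x hx).deriv]
  replace hx : 0 < x := hx
  have h1 : 0 < Real.exp x - 1 := by
    have := Real.add_one_lt_exp hx.ne'
    linarith
  have h2 : x * Real.exp (x / 2) < Real.exp x - 1 := by
    have := Real.self_lt_sinh_iff.2 (half_pos hx)
    rw [Real.sinh_eq] at this
    have h3 := mul_lt_mul_of_pos_right this (Real.exp_pos (x / 2))
    have h4 : Real.exp (x / 2) * Real.exp (x / 2) = Real.exp x := by
      rw [← Real.exp_add, add_halves]
    have h5 : Real.exp (-(x / 2)) * Real.exp (x / 2) = 1 := by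
      rw [← Real.exp_add, neg_add_cancel, Real.exp_zero]
    linarith
  have h3 : x ^ 2 * Real.exp x < (Real.exp x - 1) ^ 2 := by
    have := pow_lt_pow_left₀ h2 (by positivity) two_ne_zero
    rwa [mul_pow, ← Real.exp_nat_mul, Nat.cast_ofNat, mul_div_cancel₀ _ two_ne_zero] at this
  have : Real.exp x / (Real.exp x - 1) ^ 2 < 1 / x ^ 2 := by
    rw [div_lt_div_iff₀ (by positivity) (by positivity)]
    linarith
  linarith

theorem optimal_shaping_parameter_asymptotics
    (α : ℝ) (hα : α ∈ Set.Ioo (0 : ℝ) (1 / 2))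
    (μ : ℝ) (hμ : 0 < μ) (hμeq : α = 1 / μ - 1 / (Real.exp μ - 1))
    (t : ℕ → ℝ)
    (ht : ∀ n : ℕ, 1 ≤ n → t n ∈ Set.Ioo (0 : ℝ) n ∧ truncMoment n (t n) = α) :
    Tendsto (fun n : ℕ => (n : ℝ) * (t n / n - α)) atTop (nhds (1 / μ)) := by
  have hgap : Tendsto (fun n : ℕ => t n - n * α) atTop (nhds (1 / μ)) := by
    have hpos := fun n hn => truncVol_pos_and_first_moment hn hα.1 (ht n hn).2
    have hpair := fun n => logConcavePair_unitStep.windowAvg_iterate n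
    have hd0 : ∀ n : ℕ, 1 ≤ n → 0 ≤ t n - n * α := fun n hn =>
      nonneg_of_mul_nonneg_left ((hpos n hn).2 ▸ (hpair n).nonneg_right (t n)) (hpos n hn).1
    have hbound : ∀ l : ℝ, 0 < l → ∀ n : ℕ, 1 ≤ n →
        (t n - n * α) * (1 + l * (n * (1 / l - 1 / (Real.exp l - 1)) - t n))
          ≤ 2 / l + (n * (1 / l - 1 / (Real.exp l - 1)) - t n) := fun l hl n hn => by
      have := windowAvg_iterate_laplace_le hl n (t n)
      rw [(hpos n hn).2] at this
      refine le_of_mul_le_mul_left ?_ (hpos n hn).1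
      linarith
    rw [tendsto_order]
    constructor
    · intro a ha
      obtain ⟨b, hb, hbμ⟩ := exists_between (max_lt ha (one_div_pos.2 hμ))
      have hb0 : 0 < b := (le_max_right _ _).trans_lt hb
      have hab : a < b := (le_max_left _ _).trans_lt hb
      have hm := strictAntiOn_one_div_sub_one_div_exp_sub_one (Set.mem_Ioi.2 hμ)
        (Set.mem_Ioi.2 (one_div_pos.2 hb0)) ((lt_one_div hμ hb0).2 hbμ)
      simp only [← hμeq] at hm
      set m := 1 / (1 / b) - 1 / (Real.exp (1 / b) - 1) with hm_def
      have hlarge : ∀ᶠ n : ℕ in atTop, b + b ^ 2 / (b - a) < n * (α - m) :=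
        (tendsto_natCast_atTop_atTop.atTop_mul_const (sub_pos.2 hm)).eventually_gt_atTop _
      filter_upwards [hlarge, eventually_ge_atTop 1] with n hn hn1
      have h := hbound (1 / b) (one_div_pos.2 hb0) n hn1
      rw [← hm_def] at h
      have hd := hd0 n hn1
      by_contra! hle
      set d := t n - n * α
      have hy : n * m - t n = -(n * (α - m)) - d := by ring
      rw [hy] at h
      set q := n * (α - m)
      have hq : b ^ 2 < (q - b) * (b - a) := by
        rw [← div_lt_iff₀ (sub_pos.2 hab)]
        linarith
      have h' : d * (b - (q + d)) ≤ b * (2 * b - (q + d)) := by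
        have := mul_le_mul_of_nonneg_left h hb0.le
        field_simp at this
        linarith
      have hqb : 0 < q - b := pos_of_mul_pos_left ((sq_nonneg b).trans_lt hq) (sub_pos.2 hab).le
      have := mul_le_mul (show q - b ≤ q + d - b by linarith) (show b - a ≤ b - d by linarith)
        (sub_pos.2 hab).le (by linarith)
      linarith
    · intro a ha
      obtain ⟨b, hbμ, hba⟩ := exists_between ha
      have hb0 : 0 < b := (one_div_pos.2 hμ).trans hbμ
      have hm := strictAntiOn_one_div_sub_one_div_exp_sub_one
        (Set.mem_Ioi.2 (one_div_pos.2 hb0)) (Set.mem_Ioi.2 hμ) ((one_div_lt hμ hb0).1 hbμ)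
      simp only [← hμeq] at hm
      set m := 1 / (1 / b) - 1 / (Real.exp (1 / b) - 1) with hm_def
      have hlarge : ∀ᶠ n : ℕ in atTop, 2 * b + b ^ 2 / (a - b) < n * ((m - α) / 2) :=
        (tendsto_natCast_atTop_atTop.atTop_mul_const
          (half_pos (sub_pos.2 hm))).eventually_gt_atTop _
      filter_upwards [hlarge, eventually_ge_atTop 1] with n hn hn1
      have h := hbound (1 / b) (one_div_pos.2 hb0) n hn1
      rw [← hm_def] at h
      set z := n * ((m - α) / 2) with hz
      have hz0 : 2 * b < z := by
        have := div_pos (pow_pos hb0 2) (sub_pos.2 hba)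
        linarith
      have hd := hd0 n hn1
      have hdz : t n - n * α ≤ z := by
        by_contra! hlt
        set s := n * α + z with hs
        have hst : s ≤ t n := by linarith
        have hl := windowAvg_iterate_laplace_le (one_div_pos.2 hb0) n s
        rw [← hm_def, show n * m - s = z by rw [hs, hz]; ring] at hl
        have hinc := (hpair n).increment s (t n) hst
        have hmono := (hpair n).mono_left hst
        obtain ⟨hV, hW⟩ := hpos n hn1
        rw [hW] at hinc
        set V := windowAvg^[n] unitStep (t n)
        set v := windowAvg^[n] unitStep s
        set w := windowAvg^[n] (fun x => max x 0) s
        have hw : z * V ≤ w := by rw [hs] at hinc; linarith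
        have h1 : z * V * (1 + 1 / b * z) ≤ V * (2 / (1 / b) + z) :=
          (mul_le_mul_of_nonneg_right hw (by positivity)).trans
            (hl.trans (mul_le_mul_of_nonneg_right hmono (by positivity)))
        have h2 : z * (1 + 1 / b * z) ≤ 2 / (1 / b) + z :=
          le_of_mul_le_mul_left (by linarith) hV
        field_simp at h2
        nlinarith
      by_contra! hle
      set d := t n - n * α
      have hy : n * m - t n = 2 * z - d := by rw [hz]; ring
      rw [hy] at h
      have hq : b ^ 2 < z * (a - b) := by
        rw [← div_lt_iff₀ (sub_pos.2 hba)]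
        linarith
      have h' : d * (b + (2 * z - d)) ≤ b * (2 * b + (2 * z - d)) := by
        have := mul_le_mul_of_nonneg_left h hb0.le
        field_simp at this
        linarith
      nlinarith
  refine hgap.congr' ?_
  filter_upwards [eventually_ge_atTop 1] with n hn
  have : (n : ℝ) ≠ 0 := by positivity
  field_simp
end

section
/- Let α ∈ (0, 1/2), for each positive integer n let t_n* ∈ (0, n) be the unique solution of P_n(t_n*) = α. Then for every fixed x ∈ [0, 1), the marginal density at x of a random vector uniformly distributed on 𝒯_n(t_n*) converges to the maximum-entropy density: lim_{n→∞} V_{n−1}(t_n* − x) / V_n(t_n*) = (μ*/(1 − e^{−μ*}))·e^{−μ* x}. -/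
open MeasureTheory Filter

theorem truncCube_subset_Icc (n : ℕ) (t : ℝ) : truncCube n t ⊆ Set.Icc 0 1 :=
  fun _ hy => ⟨fun i => (hy.1 i).1, fun i => (hy.1 i).2⟩

theorem measurableSet_truncCube (n : ℕ) (t : ℝ) : MeasurableSet (truncCube n t) := by
  unfold truncCube
  measurability

theorem volume_truncCube_ne_top (n : ℕ) (t : ℝ) : volume (truncCube n t) ≠ ⊤ :=
  measure_ne_top_of_subset (truncCube_subset_Icc n t) isCompact_Icc.measure_ne_top

theorem truncVol_mono (n : ℕ) : Monotone (truncVol n) := fun _ t hst =>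
  ENNReal.toReal_mono (volume_truncCube_ne_top n t)
    (measure_mono fun _ hy => ⟨hy.1, hy.2.trans hst⟩)

open scoped Pointwise in
theorem pow_mul_truncVol_le (n : ℕ) (t : ℝ) {c : ℝ} (hc0 : 0 ≤ c) (hc1 : c ≤ 1) :
    c ^ n * truncVol n t ≤ truncVol n (c * t) := by
  have hsub : c • truncCube n t ⊆ truncCube n (c * t) := by
    rintro _ ⟨y, hy, rfl⟩
    refine ⟨fun i => ⟨mul_nonneg hc0 (hy.1 i).1, ?_⟩, ?_⟩
    · exact mul_le_one₀ hc1 (hy.1 i).1 (hy.1 i).2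
    · simp only [Pi.smul_apply, smul_eq_mul, ← Finset.mul_sum]
      exact mul_le_mul_of_nonneg_left hy.2 hc0
  have h := ENNReal.toReal_mono (volume_truncCube_ne_top n (c * t)) (measure_mono hsub)
  rwa [Measure.addHaar_smul, ENNReal.toReal_mul, Module.finrank_fin_fun,
    ENNReal.toReal_ofReal (abs_nonneg _), abs_of_nonneg (by positivity)] at h

/-- Bounds for the volume of the part of the truncated cube where the `i`-th coordinate lies in
`[x, x + η]`. -/
theorem truncVol_slab_bounds (m : ℕ) (t x η : ℝ) (hx : 0 ≤ x) (hη : 0 ≤ η) (hxη : x + η ≤ 1)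
    (i : Fin (m + 1)) :
    η * truncVol m (t - (x + η)) ≤
        volume.real (truncCube (m + 1) t ∩ {y | y i ∈ Set.Icc x (x + η)}) ∧
      volume.real (truncCube (m + 1) t ∩ {y | y i ∈ Set.Icc x (x + η)}) ≤
        η * truncVol m (t - x) := by
  have hmp := volume_preserving_piFinSuccAbove (fun _ : Fin (m + 1) => ℝ) i
  have key : ∀ s, volume ((MeasurableEquiv.piFinSuccAbove (fun _ : Fin (m + 1) => ℝ) i) ⁻¹'
      (Set.Icc x (x + η) ×ˢ truncCube m s)) = ENNReal.ofReal η * volume (truncCube m s) := by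
    intro s
    rw [hmp.measure_preimage_equiv, Measure.volume_eq_prod, Measure.prod_prod, Real.volume_Icc,
      add_sub_cancel_left]
  have key' : ∀ s, η * truncVol m s = (volume
      ((MeasurableEquiv.piFinSuccAbove (fun _ : Fin (m + 1) => ℝ) i) ⁻¹'
        (Set.Icc x (x + η) ×ˢ truncCube m s))).toReal := by
    intro s
    rw [key, ENNReal.toReal_mul, ENNReal.toReal_ofReal hη, truncVol]
  rw [key', key']
  refine ⟨ENNReal.toReal_mono ?_ (measure_mono ?_), ENNReal.toReal_mono ?_ (measure_mono ?_)⟩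
  · exact measure_ne_top_of_subset Set.inter_subset_left (volume_truncCube_ne_top _ _)
  · rintro y ⟨h1, h2⟩
    change y i ∈ Set.Icc x (x + η) at h1
    change (∀ j, y (i.succAbove j) ∈ Set.Icc (0 : ℝ) 1) ∧
      ∑ j, y (i.succAbove j) ≤ t - (x + η) at h2
    refine ⟨⟨(Fin.forall_iff_succAbove i).2 ⟨⟨hx.trans h1.1, h1.2.trans hxη⟩, h2.1⟩, ?_⟩, h1⟩
    rw [Fin.sum_univ_succAbove _ i]
    linarith [h1.2, h2.2]
  · rw [key]
    exact ENNReal.mul_ne_top ENNReal.ofReal_ne_top (volume_truncCube_ne_top _ _)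
  · rintro y ⟨h1, h2⟩
    change y i ∈ Set.Icc x (x + η) at h2
    have h3 := h1.2
    rw [Fin.sum_univ_succAbove _ i] at h3
    refine ⟨h2, fun j => h1.1 (i.succAbove j), ?_⟩
    change ∑ j, y (i.succAbove j) ≤ t - x
    linarith [h2.1]

theorem setIntegral_Icc_prod_eq_pow (n : ℕ) (f : ℝ → ℝ) :
    ∫ y in Set.Icc (0 : Fin n → ℝ) 1, ∏ i, f (y i) = (∫ u in Set.Icc (0 : ℝ) 1, f u) ^ n := by
  rw [← Set.pi_univ_Icc, volume_pi, Measure.restrict_pi_pi]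
  simpa using integral_fintype_prod_eq_pow (ι := Fin n) f
    (μ := volume.restrict (Set.Icc (0 : ℝ) 1))

theorem integrableOn_Icc_prod (n : ℕ) {f : ℝ → ℝ} (hf : IntegrableOn f (Set.Icc (0 : ℝ) 1)) :
    IntegrableOn (fun y : Fin n → ℝ => ∏ i, f (y i)) (Set.Icc (0 : Fin n → ℝ) 1) := by
  rw [← Set.pi_univ_Icc, IntegrableOn, volume_pi, Measure.restrict_pi_pi]
  exact Integrable.fintype_prod fun _ => hf

/-- Jensen's inequality for the uniform distribution on the truncated cube. -/
theorem truncVol_mul_exp_average_le (n : ℕ) (t : ℝ) (hV : 0 < truncVol n t) {h : ℝ → ℝ}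
    (hm : IntegrableOn (fun y : Fin n → ℝ => ∑ i, h (y i)) (truncCube n t))
    (he : IntegrableOn (fun u => Real.exp (h u)) (Set.Icc (0 : ℝ) 1)) :
    truncVol n t * Real.exp ((∫ y in truncCube n t, ∑ i, h (y i)) / truncVol n t) ≤
      (∫ u in Set.Icc (0 : ℝ) 1, Real.exp (h u)) ^ n := by
  set V := truncVol n t with hVdef
  set I := ∫ y in truncCube n t, ∑ i, h (y i) with hI
  set c := I / V with hc
  have hfin := volume_truncCube_ne_top n t
  have hconst : ∀ b : ℝ, IntegrableOn (fun _ : Fin n → ℝ => b) (truncCube n t) := fun b =>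
    integrableOn_const hfin
  have hprod := integrableOn_Icc_prod n he
  have hstep : ∫ y in truncCube n t, Real.exp c * (∑ i, h (y i) + (1 - c)) =
      V * Real.exp c := by
    rw [integral_const_mul, integral_add hm (hconst _), setIntegral_const, ← hI, smul_eq_mul,
      Measure.real, ← truncVol, ← hVdef, hc]
    field_simp
    ring
  rw [← hstep, ← setIntegral_Icc_prod_eq_pow]
  refine (setIntegral_mono_on ((hm.add (hconst _)).const_mul _)
    (hprod.mono_set (truncCube_subset_Icc n t)) (measurableSet_truncCube n t) ?_).trans
    (setIntegral_mono_set hprod ?_ (truncCube_subset_Icc n t).eventuallyLE)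
  · intro y _
    rw [← Real.exp_sum]
    have h1 := Real.add_one_le_exp (∑ i, h (y i) - c)
    have h2 : Real.exp (∑ i, h (y i)) = Real.exp c * Real.exp (∑ i, h (y i) - c) := by
      rw [← Real.exp_add]; ring_nf
    rw [h2]
    refine mul_le_mul_of_nonneg_left ?_ (Real.exp_pos c).le
    change ∑ i, h (y i) + (1 - c) ≤ _
    linarith
  · exact Eventually.of_forall fun y => Finset.prod_nonneg fun i _ => (Real.exp_pos _).le

/-- The exponential moment `∫₀¹ exp (s (α - u)) du`. -/
noncomputable def tiltMass (α s : ℝ) : ℝ :=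
  ∫ u in Set.Icc (0 : ℝ) 1, Real.exp (s * (α - u))

theorem integrableOn_exp_tilt (α s : ℝ) :
    IntegrableOn (fun u => Real.exp (s * (α - u))) (Set.Icc (0 : ℝ) 1) :=
  (by fun_prop : Continuous fun u => Real.exp (s * (α - u))).integrableOn_Icc

theorem tiltMass_eq (α : ℝ) {s : ℝ} (hs : s ≠ 0) :
    tiltMass α s = Real.exp (s * α) * (1 - Real.exp (-s)) / s := by
  rw [tiltMass, integral_Icc_eq_integral_Ioc, ← intervalIntegral.integral_of_le zero_le_one]
  have hd : ∀ u ∈ Set.uIcc (0 : ℝ) 1, HasDerivAt (fun u => -(Real.exp (s * (α - u)) / s))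
      (Real.exp (s * (α - u))) u := by
    intro u _
    refine ((((hasDerivAt_id u).const_sub α).const_mul s).exp.div_const s).neg.congr_deriv ?_
    simp only [id]
    field_simp
  rw [intervalIntegral.integral_eq_sub_of_hasDerivAt hd
    ((by fun_prop : Continuous fun u => Real.exp (s * (α - u))).intervalIntegrable _ _)]
  have : Real.exp (s * (α - 1)) = Real.exp (s * α) * Real.exp (-s) := by
    rw [← Real.exp_add]; ring_nf
  rw [this, sub_zero]
  ring

theorem tiltMass_pos (α : ℝ) {s : ℝ} (hs : 0 < s) : 0 < tiltMass α s := by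
  rw [tiltMass_eq α hs.ne']
  have : Real.exp (-s) < 1 := by simpa using hs
  have := sub_pos.2 this
  positivity

theorem mean_eq_mul_exp {α μ : ℝ} (hμ : 0 < μ) (hμeq : α = 1 / μ - 1 / (Real.exp μ - 1)) :
    (α - 1 / μ) * (1 - Real.exp (-μ)) + Real.exp (-μ) = 0 := by
  have h1 : 0 < Real.exp μ - 1 := by simpa using hμ
  rw [hμeq, Real.exp_neg]
  have := Real.exp_pos μ
  field_simp
  ring

theorem hasDerivAt_tiltMass {α μ : ℝ} (hμ : 0 < μ)
    (hμeq : α = 1 / μ - 1 / (Real.exp μ - 1)) : HasDerivAt (tiltMass α) 0 μ := by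
  have hev : tiltMass α =ᶠ[nhds μ] fun s => Real.exp (s * α) * (1 - Real.exp (-s)) / s := by
    filter_upwards [eventually_ne_nhds hμ.ne'] with s hs using tiltMass_eq α hs
  refine HasDerivAt.congr_of_eventuallyEq ?_ hev
  refine ((((hasDerivAt_id μ).mul_const α).exp.mul
    ((hasDerivAt_id μ).neg.exp.const_sub 1)).div (hasDerivAt_id μ) hμ.ne').congr_deriv ?_
  have h := mean_eq_mul_exp hμ hμeq
  rw [div_eq_zero_iff]
  left
  have : (α * μ - 1) * (1 - Real.exp (-μ)) + μ * Real.exp (-μ) = 0 := by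
    have := congrArg (μ * ·) h
    field_simp at this
    linarith
  simp
  linear_combination Real.exp (μ * α) * this

theorem integral_mul_exp_tilt_eq_zero {α μ : ℝ} (hμ : 0 < μ)
    (hμeq : α = 1 / μ - 1 / (Real.exp μ - 1)) :
    ∫ u in (0 : ℝ)..1, (α - u) * Real.exp (μ * (α - u)) = 0 := by
  have hd : ∀ u ∈ Set.uIcc (0 : ℝ) 1,
      HasDerivAt (fun u => (1 / μ ^ 2 - (α - u) / μ) * Real.exp (μ * (α - u)))
      ((α - u) * Real.exp (μ * (α - u))) u := by
    intro u _
    have h0 := (hasDerivAt_id u).const_sub α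
    refine (((h0.div_const μ).const_sub (1 / μ ^ 2)).mul (h0.const_mul μ).exp).congr_deriv ?_
    simp only [id]
    field_simp
    ring
  rw [intervalIntegral.integral_eq_sub_of_hasDerivAt hd
    ((by fun_prop : Continuous fun u => (α - u) * Real.exp (μ * (α - u))).intervalIntegrable _ _)]
  have h1 : Real.exp (μ * (α - 1)) = Real.exp (μ * α) * Real.exp (-μ) := by
    rw [← Real.exp_add]; ring_nf
  have h := mean_eq_mul_exp hμ hμeq
  rw [h1, sub_zero]
  linear_combination (Real.exp (μ * α) / μ) * h

theorem tiltMass_lt {α μ s : ℝ} (hμ : 0 < μ) (hμeq : α = 1 / μ - 1 / (Real.exp μ - 1))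
    (hs : μ < s) : tiltMass α μ < tiltMass α s := by
  simp only [tiltMass, integral_Icc_eq_integral_Ioc,
    ← intervalIntegral.integral_of_le (zero_le_one' ℝ)]
  have h0 : ∫ u in (0 : ℝ)..1, Real.exp (μ * (α - u)) =
      ∫ u in (0 : ℝ)..1, (Real.exp (μ * (α - u)) +
        (s - μ) * ((α - u) * Real.exp (μ * (α - u)))) := by
    rw [intervalIntegral.integral_add, intervalIntegral.integral_const_mul,
      integral_mul_exp_tilt_eq_zero hμ hμeq, mul_zero, add_zero]
    · exact Continuous.intervalIntegrable (by fun_prop) _ _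
    · exact Continuous.intervalIntegrable (by fun_prop) _ _
  rw [h0]
  have heq : ∀ u, Real.exp (s * (α - u)) =
      Real.exp (μ * (α - u)) * Real.exp ((s - μ) * (α - u)) := fun u => by
    rw [← Real.exp_add]; ring_nf
  refine intervalIntegral.integral_lt_integral_of_continuousOn_of_le_of_exists_lt zero_lt_one
    (by fun_prop) (by fun_prop) (fun u _ => ?_) ?_
  · rw [heq]
    nlinarith [Real.add_one_le_exp ((s - μ) * (α - u)), Real.exp_pos (μ * (α - u))]
  · obtain ⟨u, hu, hne⟩ : ∃ u ∈ Set.Icc (0 : ℝ) 1, α - u ≠ 0 := by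
      by_cases h : α = 0
      · exact ⟨1, by simp, by simp [h]⟩
      · exact ⟨0, by simp, by simpa using h⟩
    refine ⟨u, hu, ?_⟩
    rw [heq]
    nlinarith [Real.add_one_lt_exp (mul_ne_zero (sub_pos.2 hs).ne' hne),
      Real.exp_pos (μ * (α - u))]

/-- A small tilt of the parameter increases `tiltMass` by less than any given exponential rate. -/
theorem exists_tiltMass_mul_exp_lt {α μ δ : ℝ} (hμ : 0 < μ)
    (hμeq : α = 1 / μ - 1 / (Real.exp μ - 1)) (hδ : 0 < δ) :
    ∃ h ∈ Set.Ioo (0 : ℝ) 1,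
      tiltMass α (μ + 2 * h) * Real.exp (-(h * δ)) < tiltMass α μ := by
  have hd : HasDerivAt (fun h => tiltMass α (μ + 2 * h) * Real.exp (-(h * δ)))
      (-(tiltMass α μ * δ)) 0 := by
    have h1 : HasDerivAt (fun h : ℝ => μ + 2 * h) 2 0 := by
      simpa using ((hasDerivAt_id (0 : ℝ)).const_mul 2).const_add μ
    have h2 : HasDerivAt (fun h : ℝ => tiltMass α (μ + 2 * h)) (0 * 2) 0 :=
      HasDerivAt.comp (h₂ := tiltMass α) (0 : ℝ)
        (by simpa using hasDerivAt_tiltMass hμ hμeq) h1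
    refine (h2.mul ((hasDerivAt_id (0 : ℝ)).mul_const δ).neg.exp).congr_deriv ?_
    simp
  have hneg : -(tiltMass α μ * δ) < 0 := by
    have := tiltMass_pos α hμ
    simp only [neg_neg_iff_pos]
    positivity
  have hlt := (hasDerivAt_iff_tendsto_slope_zero.1 hd).mono_left
    (nhdsGT_le_nhdsNE 0)
  have hev := hlt.eventually_lt_const hneg
  obtain ⟨h, hh, hh2⟩ := (hev.and (Ioo_mem_nhdsGT (zero_lt_one' ℝ))).exists
  refine ⟨h, hh2, ?_⟩
  simp only [zero_add, mul_zero, add_zero, zero_mul, neg_zero, Real.exp_zero, mul_one,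
    smul_eq_mul] at hh
  have := neg_of_mul_neg_right hh (inv_pos.2 hh2.1).le
  linarith

/-- Upper bound for the mass of the exponentially tilted cube, split according to whether
`∑ i, (α - y i)` is negative, between `0` and `n * δ`, or larger. -/
theorem tiltMass_pow_le (n : ℕ) (α μ δ h : ℝ) (hμ : 0 < μ) (hh : 0 < h) :
    tiltMass α (μ + h) ^ n ≤ tiltMass α μ ^ n +
      (tiltMass α (μ + 2 * h) * Real.exp (-(h * δ))) ^ n +
      Real.exp ((μ + h) * δ) ^ n * truncVol n (n * α) := by
  have hsub := truncCube_subset_Icc n (n * α)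
  have h3 : Real.exp ((μ + h) * δ) ^ n * truncVol n (n * α) =
      ∫ y in Set.Icc (0 : Fin n → ℝ) 1,
        (truncCube n (n * α)).indicator (fun _ => Real.exp ((μ + h) * δ) ^ n) y := by
    rw [setIntegral_indicator (measurableSet_truncCube _ _), Set.inter_eq_right.2 hsub,
      setIntegral_const, smul_eq_mul, mul_comm]
    rfl
  have hi1 := integrableOn_Icc_prod n (integrableOn_exp_tilt α μ)
  have hi2 := integrableOn_Icc_prod n
    ((integrableOn_exp_tilt α (μ + 2 * h)).mul_const (Real.exp (-(h * δ))))
  have hi3 : IntegrableOn ((truncCube n (n * α)).indicator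
      (fun _ => Real.exp ((μ + h) * δ) ^ n)) (Set.Icc (0 : Fin n → ℝ) 1) :=
    (integrableOn_const isCompact_Icc.measure_ne_top).indicator (measurableSet_truncCube _ _)
  rw [h3]
  simp only [tiltMass]
  rw [← integral_mul_const]
  simp only [← setIntegral_Icc_prod_eq_pow]
  rw [← integral_add hi1 hi2]
  refine le_of_le_of_eq ?_ (integral_add (hi1.add hi2) hi3)
  refine setIntegral_mono_on (integrableOn_Icc_prod n (integrableOn_exp_tilt α (μ + h)))
    ((hi1.add hi2).add hi3) measurableSet_Icc fun y hy => ?_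
  have hprod : ∀ s b : ℝ, ∏ i, (Real.exp (s * (α - y i)) * Real.exp b) =
      Real.exp (s * (n * α - ∑ i, y i) + n * b) := by
    intro s b
    simp only [← Real.exp_add]
    rw [← Real.exp_sum]
    simp [Finset.sum_add_distrib, ← Finset.mul_sum, Finset.sum_sub_distrib]
  have hp0 : ∀ s : ℝ, ∏ i, Real.exp (s * (α - y i)) =
      Real.exp (s * (n * α - ∑ i, y i)) := by
    intro s
    simpa using hprod s 0
  change ∏ i, Real.exp ((μ + h) * (α - y i)) ≤ ∏ i, Real.exp (μ * (α - y i)) +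
    ∏ i, (Real.exp ((μ + 2 * h) * (α - y i)) * Real.exp (-(h * δ))) + _
  rw [hp0, hp0, hprod]
  set Y := n * α - ∑ i, y i with hY
  have e1 := Real.exp_pos (μ * Y)
  have e2 := Real.exp_pos ((μ + 2 * h) * Y + n * -(h * δ))
  have e3 : 0 ≤ (truncCube n (n * α)).indicator
      (fun _ => Real.exp ((μ + h) * δ) ^ n) y :=
    Set.indicator_nonneg (fun _ _ => by positivity) _
  rcases lt_or_ge Y 0 with h0 | h0
  · have : Real.exp ((μ + h) * Y) ≤ Real.exp (μ * Y) := Real.exp_le_exp.2 (by nlinarith)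
    linarith
  rcases le_or_gt Y (n * δ) with h1 | h1
  · rw [Set.indicator_of_mem (show y ∈ truncCube n (n * α) from
      ⟨fun i => ⟨hy.1 i, hy.2 i⟩, by linarith⟩), ← Real.exp_nat_mul]
    have : Real.exp ((μ + h) * Y) ≤ Real.exp (n * ((μ + h) * δ)) :=
      Real.exp_le_exp.2 (by nlinarith)
    linarith
  · have : Real.exp ((μ + h) * Y) ≤ Real.exp ((μ + 2 * h) * Y + n * -(h * δ)) :=
      Real.exp_le_exp.2 (by nlinarith)
    linarith

/-- Exponential-rate lower bound for the volume of the truncated cube. -/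
theorem eventually_pow_le_truncVol {α μ ε : ℝ} (hμ : 0 < μ)
    (hμeq : α = 1 / μ - 1 / (Real.exp μ - 1)) (hε : 0 < ε) :
    ∀ᶠ n : ℕ in atTop, (tiltMass α μ * Real.exp (-ε)) ^ n ≤ truncVol n (n * α) := by
  set δ := ε / (μ + 1) with hδdef
  have hδ : 0 < δ := by positivity
  obtain ⟨h, ⟨hh0, hh1⟩, hh⟩ := exists_tiltMass_mul_exp_lt hμ hμeq hδ
  have hlt := tiltMass_lt hμ hμeq (show μ < μ + h by linarith)
  have hpos := tiltMass_pos α hμ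
  have hspos := hpos.trans hlt
  have htend : Tendsto (fun n : ℕ => (tiltMass α μ / tiltMass α (μ + h)) ^ n) atTop (nhds 0) :=
    tendsto_pow_atTop_nhds_zero_of_lt_one (by positivity) ((div_lt_one hspos).2 hlt)
  filter_upwards [htend.eventually_le_const (show (0 : ℝ) < 1 / 3 by norm_num)] with n hn
  rw [div_pow, div_le_iff₀ (by positivity)] at hn
  have hmain := tiltMass_pow_le n α μ δ h hμ hh0
  have hrpos := tiltMass_pos α (show 0 < μ + 2 * h by linarith)
  have hle : (tiltMass α (μ + 2 * h) * Real.exp (-(h * δ))) ^ n ≤ tiltMass α μ ^ n :=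
    pow_le_pow_left₀ (by positivity) hh.le n
  have hV : 0 ≤ truncVol n (n * α) := ENNReal.toReal_nonneg
  have hexp : Real.exp ((μ + h) * δ) ^ n ≤ Real.exp ε ^ n := by
    refine pow_le_pow_left₀ (Real.exp_pos _).le (Real.exp_le_exp.2 ?_) n
    calc (μ + h) * δ ≤ (μ + 1) * δ := by gcongr
      _ = ε := by rw [hδdef]; field_simp
  have hfin : tiltMass α μ ^ n ≤ Real.exp ε ^ n * truncVol n (n * α) := by
    nlinarith [mul_le_mul_of_nonneg_right hexp hV]
  rw [mul_pow, Real.exp_neg, inv_pow, ← div_eq_mul_inv, div_le_iff₀ (by positivity)]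
  linarith

theorem integrableOn_truncCube_eval (n : ℕ) (t : ℝ) {g : ℝ → ℝ}
    (hg : IntegrableOn g (Set.Icc (0 : ℝ) 1)) (i : Fin n) :
    IntegrableOn (fun y : Fin n → ℝ => g (y i)) (truncCube n t) := by
  refine IntegrableOn.mono_set ?_ (truncCube_subset_Icc n t)
  rw [← Set.pi_univ_Icc, IntegrableOn, volume_pi, Measure.restrict_pi_pi]
  exact integrable_comp_eval (μ := fun _ : Fin n => volume.restrict (Set.Icc (0 : ℝ) 1)) hg

theorem truncMoment_eq_imp {n : ℕ} (hn : 1 ≤ n) {α t : ℝ} (hα : 0 < α)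
    (h : truncMoment n t = α) :
    0 < truncVol n t ∧ n * α ≤ t ∧
      ∫ y in truncCube n t, ∑ i, y i = n * α * truncVol n t := by
  have hn' : (0 : ℝ) < n := by exact_mod_cast hn
  have hV : 0 < truncVol n t := by
    refine lt_of_le_of_ne ENNReal.toReal_nonneg fun h0 => ?_
    rw [truncMoment, ← h0] at h
    simp at h
    exact hα.ne h
  have hint : ∫ y in truncCube n t, ∑ i, y i = n * α * truncVol n t := by
    rw [← h, truncMoment]
    field_simp
  refine ⟨hV, ?_, hint⟩
  have hle : ∫ y in truncCube n t, ∑ i, y i ≤ ∫ _ in truncCube n t, t := by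
    refine setIntegral_mono_on (integrable_finsetSum _ fun i _ => ?_)
      (integrableOn_const (volume_truncCube_ne_top n t)) (measurableSet_truncCube n t)
      fun y hy => hy.2
    exact integrableOn_truncCube_eval n t (g := fun u => u) continuous_id.integrableOn_Icc i
  rw [hint, setIntegral_const, smul_eq_mul, mul_comm _ t] at hle
  exact le_of_mul_le_mul_right hle hV

/-- Under the uniform distribution on a truncated cube with average first moment `α`, the expected
fraction of coordinates in a set `A` converges to the probability of `A` under the
maximum-entropy density. -/
theorem eventually_abs_sum_slab_sub_le {α μ : ℝ} (hα : 0 < α) (hμ : 0 < μ)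
    (hμeq : α = 1 / μ - 1 / (Real.exp μ - 1)) {t : ℕ → ℝ}
    (ht : ∀ n : ℕ, 1 ≤ n → truncMoment n (t n) = α) {A : Set ℝ} (hA : MeasurableSet A)
    (hA1 : A ⊆ Set.Icc 0 1) {κ : ℝ} (hκ0 : 0 < κ) (hκ1 : κ ≤ 1) :
    ∀ᶠ n : ℕ in atTop,
      |(∑ i : Fin n, volume.real (truncCube n (t n) ∩ {y | y i ∈ A})) / (n * truncVol n (t n)) -
        (∫ u in A, Real.exp (μ * (α - u))) / tiltMass α μ| ≤ 2 * κ := by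
  set G := tiltMass α μ with hG
  set P := (∫ u in A, Real.exp (μ * (α - u))) / G with hP
  have hGpos : 0 < G := tiltMass_pos α hμ
  have hIA : ∫ u in A, Real.exp (μ * (α - u)) = P * G := by rw [hP]; field_simp
  have hP0 : 0 ≤ P := by
    have : 0 ≤ ∫ u in A, Real.exp (μ * (α - u)) :=
      integral_nonneg fun u => (Real.exp_pos _).le
    positivity
  have hP1 : P ≤ 1 := by
    rw [hP, div_le_one hGpos]
    exact setIntegral_mono_set (integrableOn_exp_tilt α μ)
      (Eventually.of_forall fun u => (Real.exp_pos _).le) hA1.eventuallyLE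
  have hexpA : ∀ l u : ℝ, Real.exp (A.indicator (fun _ => l) u + μ * (α - u)) =
      Real.exp (μ * (α - u)) +
        A.indicator (fun u => (Real.exp l - 1) * Real.exp (μ * (α - u))) u := by
    intro l u
    by_cases hu : u ∈ A
    · simp [hu, Real.exp_add]; ring
    · simp [hu]
  have hindI : ∀ l : ℝ, IntegrableOn
      (A.indicator (fun u => (Real.exp l - 1) * Real.exp (μ * (α - u)))) (Set.Icc (0 : ℝ) 1) :=
    fun l => Integrable.indicator ((integrableOn_exp_tilt α μ).const_mul _) hA
  have hmass : ∀ l : ℝ, ∫ u in Set.Icc (0 : ℝ) 1,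
      Real.exp (A.indicator (fun _ => l) u + μ * (α - u)) = G * (1 + (Real.exp l - 1) * P) := by
    intro l
    simp only [hexpA]
    rw [integral_add (integrableOn_exp_tilt α μ) (hindI l), setIntegral_indicator hA,
      Set.inter_eq_right.2 hA1, integral_const_mul, hIA, ← tiltMass, ← hG]
    ring
  have hmassI : ∀ l : ℝ, IntegrableOn
      (fun u => Real.exp (A.indicator (fun _ => l) u + μ * (α - u))) (Set.Icc (0 : ℝ) 1) := by
    intro l
    simp only [hexpA]
    exact (integrableOn_exp_tilt α μ).add (hindI l)
  filter_upwards [eventually_pow_le_truncVol hμ hμeq (show 0 < κ ^ 2 by positivity),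
    eventually_ge_atTop 1] with n hlow hn
  obtain ⟨hV, htn, hmom⟩ := truncMoment_eq_imp hn hα (ht n hn)
  have hn' : (0 : ℝ) < n := by exact_mod_cast hn
  set V := truncVol n (t n) with hVdef
  set S := (∑ i : Fin n, volume.real (truncCube n (t n) ∩ {y | y i ∈ A})) / (n * V) with hS
  have hVlow : (G * Real.exp (-κ ^ 2)) ^ n ≤ V := hlow.trans (truncVol_mono n htn)
  have hI1 : ∀ (l : ℝ) (i : Fin n), IntegrableOn
      (fun y : Fin n → ℝ => A.indicator (fun _ => l) (y i)) (truncCube n (t n)) := fun l i =>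
    integrableOn_truncCube_eval n _ (g := A.indicator fun _ => l)
      ((integrableOn_const isCompact_Icc.measure_ne_top).indicator hA) i
  have hI2 : ∀ i : Fin n, IntegrableOn (fun y : Fin n → ℝ => y i) (truncCube n (t n)) := fun i =>
    integrableOn_truncCube_eval n _ (g := fun u => u) continuous_id.integrableOn_Icc i
  have hI3 : IntegrableOn (fun y : Fin n → ℝ => ∑ i, y i) (truncCube n (t n)) :=
    integrable_finsetSum _ fun i _ => hI2 i
  have hI4 : ∀ l : ℝ, IntegrableOn (fun y : Fin n → ℝ => ∑ i, A.indicator (fun _ => l) (y i))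
      (truncCube n (t n)) := fun l => integrable_finsetSum _ fun i _ => hI1 l i
  have hI0 : IntegrableOn (fun _ : Fin n → ℝ => n * α) (truncCube n (t n)) :=
    integrableOn_const (volume_truncCube_ne_top n _)
  have hI5 : IntegrableOn (fun y : Fin n → ℝ => n * α - ∑ i, y i) (truncCube n (t n)) :=
    hI0.sub hI3
  have hsum : ∀ (l : ℝ) (y : Fin n → ℝ), ∑ i, (A.indicator (fun _ => l) (y i) + μ * (α - y i)) =
      ∑ i, A.indicator (fun _ => l) (y i) + μ * (n * α - ∑ i, y i) := by
    intro l y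
    simp [Finset.sum_add_distrib, ← Finset.mul_sum, Finset.sum_sub_distrib]
  have hone : ∀ (l : ℝ) (i : Fin n),
      ∫ y in truncCube n (t n), A.indicator (fun _ => l) (y i) =
        l * volume.real (truncCube n (t n) ∩ {y | y i ∈ A}) := by
    intro l i
    have : (fun y : Fin n → ℝ => A.indicator (fun _ => l) (y i)) =
        {y : Fin n → ℝ | y i ∈ A}.indicator fun _ => l := rfl
    have hmeas : MeasurableSet {y : Fin n → ℝ | y i ∈ A} := measurable_pi_apply i hA
    rw [this, setIntegral_indicator hmeas, setIntegral_const, smul_eq_mul, mul_comm]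
  have hkey : ∀ l : ℝ, l * S ≤ κ ^ 2 + (Real.exp l - 1) * P := by
    intro l
    have hJ := truncVol_mul_exp_average_le n (t n) hV
      (h := fun u => A.indicator (fun _ => l) u + μ * (α - u))
      (by simp only [hsum]; exact (hI4 l).add (hI5.const_mul μ)) (hmassI l)
    have hint : ∫ y in truncCube n (t n),
        ∑ i, (A.indicator (fun _ => l) (y i) + μ * (α - y i)) = n * (l * S) * V := by
      simp only [hsum]
      rw [integral_add (hI4 l) (hI5.const_mul μ), integral_const_mul,
        integral_sub hI0 hI3, hmom,
        setIntegral_const, integral_finsetSum _ fun i _ => hI1 l i, hS]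
      simp only [hone, ← Finset.mul_sum, smul_eq_mul, Measure.real]
      rw [← truncVol, ← hVdef]
      field_simp
      ring
    rw [hint, hmass, mul_div_assoc, div_self hV.ne', mul_one] at hJ
    have h1 : G * (1 + (Real.exp l - 1) * P) ≤ G * Real.exp ((Real.exp l - 1) * P) := by
      gcongr
      linarith [Real.add_one_le_exp ((Real.exp l - 1) * P)]
    have h0 : 0 ≤ G * (1 + (Real.exp l - 1) * P) :=
      mul_nonneg hGpos.le (by nlinarith [Real.exp_pos l])
    have h2 := (mul_le_mul_of_nonneg_right hVlow (Real.exp_pos (n * (l * S))).le).trans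
      (hJ.trans (pow_le_pow_left₀ h0 h1 n))
    rw [Real.exp_nat_mul, ← mul_pow, mul_assoc, ← Real.exp_add] at h2
    have h3 := lt_or_ge (Real.exp ((Real.exp l - 1) * P)) (Real.exp (-κ ^ 2 + l * S))
    rcases h3 with h3 | h3
    · exact absurd h2 (not_le.2 (pow_lt_pow_left₀ (mul_lt_mul_of_pos_left h3 hGpos)
        (by positivity) (by omega)))
    · linarith [Real.exp_le_exp.1 h3]
  have hquad : ∀ l : ℝ, |l| = κ → l * S ≤ κ ^ 2 + (l + κ ^ 2) * P := by
    intro l hl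
    have h1 := (abs_le.1 (Real.abs_exp_sub_one_sub_id_le (hl.le.trans hκ1))).2
    rw [← sq_abs, hl] at h1
    exact (hkey l).trans (by gcongr; linarith)
  have hup := hquad κ (abs_of_pos hκ0)
  have hdn := hquad (-κ) (by rw [abs_neg, abs_of_pos hκ0])
  have hκP : κ ^ 2 * P ≤ κ ^ 2 := mul_le_of_le_one_right (by positivity) hP1
  rw [abs_le]
  constructor
  · refine le_of_mul_le_mul_left ?_ hκ0
    nlinarith
  · refine le_of_mul_le_mul_left ?_ hκ0
    nlinarith

/-- The volume of a truncated cube varies little under a shift of its parameter. -/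
theorem truncVol_sub_ge {m : ℕ} (hm : 1 ≤ m) {β s y : ℝ} (hβ : 0 < β) (hy : 0 ≤ y) (hyβ : y ≤ β)
    (hs : m * β ≤ s) : (1 - y / β) * truncVol m s ≤ truncVol m (s - y) := by
  have hV : 0 ≤ truncVol m s := ENNReal.toReal_nonneg
  have hm' : (1 : ℝ) ≤ m := by exact_mod_cast hm
  have hb : y / β ≤ 1 := (div_le_one hβ).2 hyβ
  have hb0 : 0 ≤ y / β := by positivity
  set a := y / β with ha
  have ham : a / m ≤ 1 := (div_le_one (by positivity)).2 (hb.trans hm')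
  have ham0 : 0 ≤ a / m := by positivity
  have hbern := one_add_mul_le_pow (show -2 ≤ -(a / m) by linarith) m
  have hscale := pow_mul_truncVol_le m s (c := 1 + -(a / m)) (by linarith) (by linarith)
  have hmono : truncVol m ((1 + -(a / m)) * s) ≤ truncVol m (s - y) := by
    apply truncVol_mono
    have : y ≤ a / m * s := by
      calc y = a / m * (m * β) := by rw [ha]; field_simp
        _ ≤ _ := by gcongr
    linarith
  have hm1 : 1 + m * -(a / m) = 1 - a := by field_simp; ring
  rw [hm1] at hbern
  exact (mul_le_mul_of_nonneg_right hbern hV).trans (hscale.trans hmono)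

/-- Two-sided bounds for the marginal density at `x`, at resolution `η`. -/
theorem eventually_marginal_density_bounds {α μ : ℝ} (hα : 0 < α) (hμ : 0 < μ)
    (hμeq : α = 1 / μ - 1 / (Real.exp μ - 1)) {t : ℕ → ℝ}
    (ht : ∀ n : ℕ, 1 ≤ n → truncMoment n (t n) = α) {x η : ℝ} (hx : 0 ≤ x) (hη : 0 < η)
    (hxη : x + η ≤ 1) (hηα : η < α / 2) :
    ∀ᶠ n : ℕ in atTop,
      Real.exp (μ * (α - (x + η))) / tiltMass α μ - η ≤
          truncVol (n - 1) (t n - x) / truncVol n (t n) ∧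
        truncVol (n - 1) (t n - x) / truncVol n (t n) ≤
          (Real.exp (μ * (α - x)) / tiltMass α μ + η) / (1 - 2 * η / α) := by
  have hG := tiltMass_pos α hμ
  have hη1 : η ≤ 1 := by linarith
  have hA1 : Set.Icc x (x + η) ⊆ Set.Icc 0 1 := Set.Icc_subset_Icc hx hxη
  have hvol : volume.real (Set.Icc x (x + η)) = η := by
    rw [Real.volume_real_Icc_of_le (by linarith)]; ring
  have hAint : IntegrableOn (fun u => Real.exp (μ * (α - u))) (Set.Icc x (x + η)) :=
    (integrableOn_exp_tilt α μ).mono_set hA1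
  have hPlow : η * Real.exp (μ * (α - (x + η))) ≤
      ∫ u in Set.Icc x (x + η), Real.exp (μ * (α - u)) := by
    have := setIntegral_mono_on (f := fun _ => Real.exp (μ * (α - (x + η))))
      (integrableOn_const isCompact_Icc.measure_ne_top) hAint measurableSet_Icc
      fun u hu => Real.exp_le_exp.2 (mul_le_mul_of_nonneg_left (by linarith [hu.2]) hμ.le)
    rwa [setIntegral_const, hvol, smul_eq_mul] at this
  have hPup : ∫ u in Set.Icc x (x + η), Real.exp (μ * (α - u)) ≤
      η * Real.exp (μ * (α - x)) := by
    have := setIntegral_mono_on (g := fun _ => Real.exp (μ * (α - x))) hAint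
      (integrableOn_const isCompact_Icc.measure_ne_top) measurableSet_Icc
      fun u hu => Real.exp_le_exp.2 (mul_le_mul_of_nonneg_left (by linarith [hu.1]) hμ.le)
    rwa [setIntegral_const, hvol, smul_eq_mul] at this
  have hlarge : ∀ᶠ n : ℕ in atTop, 2 ≤ n * α :=
    (tendsto_natCast_atTop_atTop.atTop_mul_const hα).eventually_ge_atTop 2
  filter_upwards [eventually_abs_sum_slab_sub_le hα hμ hμeq ht measurableSet_Icc hA1
    (show 0 < η ^ 2 / 2 by positivity) (by nlinarith), eventually_ge_atTop 2, hlarge]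
    with n habs hn2 hnα
  have hn : 1 ≤ n := by omega
  obtain ⟨hV, htn, -⟩ := truncMoment_eq_imp hn hα (ht n hn)
  obtain ⟨m, rfl⟩ : ∃ m, n = m + 1 := ⟨n - 1, by omega⟩
  have hm : 1 ≤ m := by omega
  rw [Nat.add_sub_cancel]
  have hn' : (0 : ℝ) < ((m + 1 : ℕ) : ℝ) := by positivity
  set V := truncVol (m + 1) (t (m + 1)) with hVdef
  set q := truncVol m (t (m + 1) - x) / V with hq
  set S := (∑ i : Fin (m + 1), volume.real
    (truncCube (m + 1) (t (m + 1)) ∩ {y | y i ∈ Set.Icc x (x + η)})) / ((m + 1 : ℕ) * V) with hS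
  have hslab := truncVol_slab_bounds m (t (m + 1)) x η hx hη.le hxη
  have hSup : S ≤ η * q := by
    have := Finset.sum_le_sum fun i (_ : i ∈ Finset.univ) => (hslab i).2
    rw [Finset.sum_const, Finset.card_univ, Fintype.card_fin, nsmul_eq_mul] at this
    rw [hS, hq, div_le_iff₀ (by positivity)]
    refine this.trans_eq ?_
    field_simp
  have hshift := truncVol_sub_ge hm (s := t (m + 1) - x) (half_pos hα) hη.le hηα.le (by
    push_cast at htn hnα
    linarith)
  have hfac : η / (α / 2) = 2 * η / α := by field_simp
  have hfac1 : 0 < 1 - 2 * η / α := by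
    rw [← hfac, sub_pos, div_lt_one (by positivity)]
    exact hηα
  rw [hfac, sub_sub] at hshift
  have hSlow : η * ((1 - 2 * η / α) * q) ≤ S := by
    have := Finset.sum_le_sum fun i (_ : i ∈ Finset.univ) => (hslab i).1
    rw [Finset.sum_const, Finset.card_univ, Fintype.card_fin, nsmul_eq_mul] at this
    rw [hS, le_div_iff₀ (by positivity)]
    refine le_trans ?_ this
    calc η * ((1 - 2 * η / α) * q) * ((m + 1 : ℕ) * V)
        = (m + 1 : ℕ) * (η * ((1 - 2 * η / α) * truncVol m (t (m + 1) - x))) := by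
          rw [hq]; field_simp
      _ ≤ _ := by gcongr
  obtain ⟨habs1, habs2⟩ := abs_le.1 habs
  have hPlow' := div_le_div_of_nonneg_right hPlow hG.le
  have hPup' := div_le_div_of_nonneg_right hPup hG.le
  rw [mul_div_assoc] at hPlow' hPup'
  constructor
  · refine le_of_mul_le_mul_left ?_ hη
    nlinarith
  · rw [le_div_iff₀ hfac1]
    refine le_of_mul_le_mul_left ?_ hη
    nlinarith

theorem marginal_density_tendsto_max_entropy_density
    (α : ℝ) (hα : α ∈ Set.Ioo (0 : ℝ) (1 / 2))
    (μ : ℝ) (hμ : 0 < μ) (hμeq : α = 1 / μ - 1 / (Real.exp μ - 1))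
    (t : ℕ → ℝ)
    (ht : ∀ n : ℕ, 1 ≤ n → t n ∈ Set.Ioo (0 : ℝ) n ∧ truncMoment n (t n) = α)
    (x : ℝ) (hx : x ∈ Set.Ico (0 : ℝ) 1) :
    Tendsto (fun n : ℕ => truncVol (n - 1) (t n - x) / truncVol n (t n)) atTop
      (nhds (μ / (1 - Real.exp (-μ)) * Real.exp (-μ * x))) := by
  have hlim : μ / (1 - Real.exp (-μ)) * Real.exp (-μ * x) =
      Real.exp (μ * (α - x)) / tiltMass α μ := by
    have h1 : Real.exp (μ * (α - x)) = Real.exp (μ * α) * Real.exp (-μ * x) := by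
      rw [← Real.exp_add]; ring_nf
    have h2 : 0 < 1 - Real.exp (-μ) := by simpa using hμ
    rw [tiltMass_eq α hμ.ne', h1]
    field_simp
  rw [hlim]
  have hbound : ∀ᶠ η in nhdsWithin (0 : ℝ) (Set.Ioi 0), 0 < η ∧ x + η ≤ 1 ∧ η < α / 2 := by
    filter_upwards [Ioo_mem_nhdsGT (sub_pos.2 hx.2), Ioo_mem_nhdsGT (half_pos hα.1)] with η h1 h2
    exact ⟨h1.1, by linarith [h1.2], h2.2⟩
  have hl : Tendsto (fun η => Real.exp (μ * (α - (x + η))) / tiltMass α μ - η)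
      (nhdsWithin 0 (Set.Ioi 0)) (nhds (Real.exp (μ * (α - x)) / tiltMass α μ)) := by
    have hc : Continuous fun η => Real.exp (μ * (α - (x + η))) / tiltMass α μ - η := by fun_prop
    exact tendsto_nhdsWithin_of_tendsto_nhds (hc.tendsto' 0 _ (by simp))
  have hu : Tendsto (fun η => (Real.exp (μ * (α - x)) / tiltMass α μ + η) / (1 - 2 * η / α))
      (nhdsWithin 0 (Set.Ioi 0)) (nhds (Real.exp (μ * (α - x)) / tiltMass α μ)) := by
    have hc : ContinuousAt
        (fun η => (Real.exp (μ * (α - x)) / tiltMass α μ + η) / (1 - 2 * η / α)) 0 :=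
      ContinuousAt.div (by fun_prop) (by fun_prop) (by simp)
    exact tendsto_nhdsWithin_of_tendsto_nhds (by simpa [ContinuousAt] using hc)
  have hmain := fun η (h : 0 < η ∧ x + η ≤ 1 ∧ η < α / 2) =>
    eventually_marginal_density_bounds hα.1 hμ hμeq (fun n hn => (ht n hn).2) hx.1 h.1 h.2.1 h.2.2
  refine tendsto_order.2 ⟨fun a ha => ?_, fun b hb => ?_⟩
  · obtain ⟨η, hη, hη'⟩ := ((hl.eventually_const_lt ha).and hbound).exists
    filter_upwards [hmain η hη'] with n hn using hη.trans_le hn.1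
  · obtain ⟨η, hη, hη'⟩ := ((hu.eventually_lt_const hb).and hbound).exists
    filter_upwards [hmain η hη'] with n hn using hn.2.trans_lt hη
end
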